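/- (Power Learning Theorem.) Let X be a random vector on ℝ^d whose law has a strictly positive density f_X with respect to Lebesgue measure, with x ↦ log f_X(x) differentiable. Let g_0, …, g_{p−1} : ℝ^d → ℝ^d be C²-diffeomorphisms, set G = g_{p−1} ∘ ⋯ ∘ g_0, and for each x define w_0 = x, w_{k+1} = g_k(w_k), and J_k(x) = Dg_k(w_k), so that x ↦ log|det J_k(x)| is differentiable. Let h_Z(z) = f_X(G^{-1}(z)) |det DG^{-1}(z)| be the density of Z = G(X). If for all x ∈ ℝ^d we have ‖∇_x log f_X(x) − Σ_{k=0}^{p−1} ∇_x log|det J_k(x)|‖₂ ≤ ε, then for all x ∈ ℝ^d the gradient of the map x ↦ log h_Z(G(x)) satisfies ‖∇_x log h_Z(G(x))‖₂ ≤ ε. -/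

import Mathlib

/-- `iterComp g k = g (k-1) ∘ ⋯ ∘ g 0`, so that `iterComp g k x` is the
intermediate activation `w_k` (with `w_0 = x`). -/
def iterComp {E : Type*} (g : ℕ → E → E) : ℕ → E → E
  | 0 => id
  | (k + 1) => g k ∘ iterComp g k

theorem differentiable_iterComp {E : Type*} [NormedAddCommGroup E] [NormedSpace ℝ E]
    {g : ℕ → E → E} (hg : ∀ k, Differentiable ℝ (g k)) (n : ℕ) :
    Differentiable ℝ (iterComp g n) := by
  induction n with
  | zero => exact differentiable_id
  | succ n ih => exact (hg n).comp ih

theorem det_fderiv_iterComp {E : Type*} [NormedAddCommGroup E] [NormedSpace ℝ E]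
    {g : ℕ → E → E} (hg : ∀ k, Differentiable ℝ (g k)) (n : ℕ) (x : E) :
    (fderiv ℝ (iterComp g n) x).det =
      ∏ k ∈ Finset.range n, (fderiv ℝ (g k) (iterComp g k x)).det := by
  induction n with
  | zero => simp [iterComp, ContinuousLinearMap.det]
  | succ n ih =>
    rw [Finset.prod_range_succ, ← ih, mul_comm]
    simp only [iterComp]
    rw [fderiv_comp x (hg n _) (differentiable_iterComp hg n x)]
    exact LinearMap.det_comp _ _

theorem det_fderiv_mul_of_leftInverse {E : Type*} [NormedAddCommGroup E] [NormedSpace ℝ E]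
    {f h : E → E} (hf : Differentiable ℝ f) (hh : Differentiable ℝ h)
    (hinv : Function.LeftInverse h f) (x : E) :
    (fderiv ℝ h (f x)).det * (fderiv ℝ f x).det = 1 := by
  have hcomp : (fderiv ℝ h (f x)).comp (fderiv ℝ f x) = ContinuousLinearMap.id ℝ E := by
    rw [← fderiv_comp x (hh _) (hf x), hinv.comp_eq_id, fderiv_id]
  have hdet := congrArg ContinuousLinearMap.det hcomp
  simp only [ContinuousLinearMap.det, ContinuousLinearMap.toLinearMap_comp,
    ContinuousLinearMap.coe_id, LinearMap.det_comp, LinearMap.det_id] at hdet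
  exact hdet

/-- **Power Learning Theorem.** Let `X` have strictly positive density `f_X` with
differentiable log-density, let `G = g_{p−1} ∘ ⋯ ∘ g_0` be a composition of
`C²`-diffeomorphisms with intermediate Jacobians `J_k(x) = Dg_k(w_k)`, and
let `h_Z(z) = f_X(G⁻¹(z)) |det DG⁻¹(z)|` be the density of `Z = G(X)`.
If `‖∇ₓ log f_X(x) − Σ_k ∇ₓ log |det J_k(x)|‖₂ ≤ ε` for all `x`, then
`‖∇ₓ log h_Z(G(x))‖₂ ≤ ε` for all `x`, i.e. the output achieves
`ε`-Lipschitz privacy. -/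
theorem power_learning {d p : ℕ} (ε : ℝ)
    (fX : EuclideanSpace ℝ (Fin d) → ℝ) (hfX_pos : ∀ x, 0 < fX x)
    (hfX_logdiff : Differentiable ℝ (fun x => Real.log (fX x)))
    (g ginv : ℕ → EuclideanSpace ℝ (Fin d) → EuclideanSpace ℝ (Fin d))
    (hg : ∀ k, ContDiff ℝ 2 (g k)) (hginv : ∀ k, ContDiff ℝ 2 (ginv k))
    (hleft : ∀ k, Function.LeftInverse (ginv k) (g k))
    (hright : ∀ k, Function.RightInverse (ginv k) (g k))
    (hJ_logdiff : ∀ k, Differentiable ℝ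
      (fun x => Real.log |(fderiv ℝ (g k) (iterComp g k x)).det|))
    (Ginv : EuclideanSpace ℝ (Fin d) → EuclideanSpace ℝ (Fin d))
    (hGinv : ContDiff ℝ 2 Ginv)
    (hGleft : Function.LeftInverse Ginv (iterComp g p))
    (hGright : Function.RightInverse Ginv (iterComp g p))
    (hZ : EuclideanSpace ℝ (Fin d) → ℝ)
    (hhZ : ∀ z, hZ z = fX (Ginv z) * |(fderiv ℝ Ginv z).det|)
    (hbound : ∀ x, ‖gradient (fun x => Real.log (fX x)) x -
      ∑ k ∈ Finset.range p,
        gradient (fun x => Real.log |(fderiv ℝ (g k) (iterComp g k x)).det|) x‖ ≤ ε) :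
    ∀ x, ‖gradient (fun x => Real.log (hZ (iterComp g p x))) x‖ ≤ ε := by
  intro x
  have hgd k : Differentiable ℝ (g k) := (hg k).differentiable (by norm_num)
  have hgid k : Differentiable ℝ (ginv k) := (hginv k).differentiable (by norm_num)
  have hGinvd : Differentiable ℝ Ginv := hGinv.differentiable (by norm_num)
  have hlog : (fun x => Real.log (hZ (iterComp g p x))) = fun x => Real.log (fX x) -
      ∑ k ∈ Finset.range p, Real.log |(fderiv ℝ (g k) (iterComp g k x)).det| := by
    funext y
    have hinv := det_fderiv_mul_of_leftInverse (differentiable_iterComp hgd p) hGinvd hGleft y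
    have hJ k : |(fderiv ℝ (g k) (iterComp g k y)).det| ≠ 0 := abs_ne_zero.mpr
      (right_ne_zero_of_mul_eq_one (det_fderiv_mul_of_leftInverse (hgd k) (hgid k) (hleft k) _))
    have hdet : |(fderiv ℝ Ginv (iterComp g p y)).det| ≠ 0 :=
      abs_ne_zero.mpr (left_ne_zero_of_mul_eq_one hinv)
    rw [hhZ, hGleft, Real.log_mul (hfX_pos y).ne' hdet, ← Real.log_prod fun k _ => hJ k,
      ← Finset.abs_prod, ← det_fderiv_iterComp hgd, eq_inv_of_mul_eq_one_left hinv, abs_inv,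
      Real.log_inv, sub_eq_add_neg]
  have hgrad := (hfX_logdiff x).hasFDerivAt.sub
    (HasFDerivAt.fun_sum (u := Finset.range p) fun k _ => (hJ_logdiff k x).hasFDerivAt)
  rw [hlog]
  convert hbound x using 2
  simp only [gradient]
  rw [← map_sum, ← map_sub]
  exact congrArg _ hgrad.fderiv
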